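/- arXiv:1610.01998 — 2 statements merged into one kernel-verified Lean document; each statement's English description precedes it below -/
import Mathlib

section
/- For every real λ with 0 < λ ≤ 1/2 and every integer n ≥ 1: if n is odd, the pair (f,g) with f(y) = 1 if y ≥ 2^{(n+1)/2} and f(y) = 0 otherwise, and g(z) = 1 if z ≥ 2^n and g(z) = 0 otherwise, is a common function of Y and Z with respect to the (Y,Z)-marginal of b^{(n,λ)} taking both values 0 and 1 on the support; moreover every common function (f',g') of Y and Z is constant on each of the two level sets of f intersected with the support (i.e., every common function factors through (f,g)). If n is even, the same holds with X in the role of Y: f(x) = 1 iff x ≥ 2^{n/2+1}, g(z) = 1 iff z ≥ 2^n is a common function of X and Z through which every common function of X and Z factors. (Proposition 1, part 2, binary half: for odd n the maximal common information J_{YZ} is binary, and for even n the maximal common information J_{XZ} is binary.) -/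
/-- The "fold" permutation σ_t : shifts odd values by ±t (within blocks of size 2t),
fixes even values. -/
def origamiSig (t k : ℕ) : ℕ :=
  if k % 2 = 1 then (if k % (2 * t) < t then k + t else k - t) else k

/-- The map producing the new block `T_n` from `S_n`. -/
def origamiFold (n : ℕ) (s : Finset (ℕ × ℕ × ℕ)) : Finset (ℕ × ℕ × ℕ) :=
  if n % 2 = 1 then
    s.image (fun p =>
      (p.1 + 2 ^ ((n + 3) / 2), origamiSig (2 ^ ((n + 1) / 2)) p.2.1, p.2.2 + 2 ^ (n + 1)))
  else
    s.image (fun p =>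
      (origamiSig (2 ^ (n / 2 + 1)) p.1, p.2.1 + 2 ^ (n / 2 + 1), p.2.2 + 2 ^ (n + 1)))

/-- The support `S_n` of the origami distribution. -/
def origamiS : ℕ → Finset (ℕ × ℕ × ℕ)
  | 0 => ∅
  | 1 => {(0,0,0), (1,1,0), (3,0,1), (2,1,1), (0,2,2), (3,3,2), (2,3,3), (1,2,3)}
  | (n + 2) => origamiS (n + 1) ∪ origamiFold (n + 1) (origamiS (n + 1))

/-- The origami distribution `b^{(n,λ)}` on ℕ³: probability `2^{-(n+1)}·λ` on points of
`S_n` with even `x`, `2^{-(n+1)}·(1-λ)` on points of `S_n` with odd `x`, and `0` elsewhere. -/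
noncomputable def origamiB (n : ℕ) (lam : ℝ) (p : ℕ × ℕ × ℕ) : ℝ :=
  if p ∈ origamiS n then (if p.1 % 2 = 0 then lam else 1 - lam) / 2 ^ (n + 1) else 0

/-- The candidate maximal common function on Bob's side for odd `n` :
`f y = 1` iff `y ≥ 2^{(n+1)/2}`. -/
def origamiFOddY (n y : ℕ) : ℕ := if 2 ^ ((n + 1) / 2) ≤ y then 1 else 0

/-- The candidate maximal common function on Alice's side for even `n` :
`f x = 1` iff `x ≥ 2^{n/2+1}`. -/
def origamiFEvenX (n x : ℕ) : ℕ := if 2 ^ (n / 2 + 1) ≤ x then 1 else 0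

/-- The candidate maximal common function on Eve's side: `g z = 1` iff `z ≥ 2^n`. -/
def origamiGZ (n z : ℕ) : ℕ := if 2 ^ n ≤ z then 1 else 0

theorem tsum_pos_iff_exists_pos_of_finite_support {ι : Type*} {F : ι → ℝ} (hF : ∀ i, 0 ≤ F i)
    (hfin : F.support.Finite) : 0 < ∑' i, F i ↔ ∃ i, 0 < F i := by
  constructor
  · intro h
    by_contra! hneg
    have hzero : ∀ i, F i = 0 := fun i => le_antisymm (hneg i) (hF i)
    simp [hzero] at h
  · rintro ⟨i, hi⟩
    exact (summable_of_hasFiniteSupport hfin).tsum_pos hF i hi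

section Positivity

variable {n : ℕ} {lam : ℝ}

theorem origamiB_nonneg (h0 : 0 < lam) (h1 : lam ≤ 1 / 2) (p : ℕ × ℕ × ℕ) :
    0 ≤ origamiB n lam p := by
  have h : 0 ≤ 1 - lam := by linarith
  unfold origamiB
  split_ifs <;> positivity

theorem origamiB_pos_iff (h0 : 0 < lam) (h1 : lam ≤ 1 / 2) (p : ℕ × ℕ × ℕ) :
    0 < origamiB n lam p ↔ p ∈ origamiS n := by
  have h : 0 < 1 - lam := by linarith
  unfold origamiB
  split_ifs with hp
  · exact iff_of_true (by positivity) hp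
  · exact iff_of_true (by positivity) hp
  · exact iff_of_false (lt_irrefl _) hp

/-- The support of the `(X,Z)`-marginal of the origami distribution. -/
def origamiXZ (n x z : ℕ) : Prop := ∃ y, (x, y, z) ∈ origamiS n

/-- The support of the `(Y,Z)`-marginal of the origami distribution. -/
def origamiYZ (n y z : ℕ) : Prop := ∃ x, (x, y, z) ∈ origamiS n

theorem tsum_origamiB_fst_pos_iff (h0 : 0 < lam) (h1 : lam ≤ 1 / 2) (y z : ℕ) :
    0 < ∑' x, origamiB n lam (x, y, z) ↔ origamiYZ n y z := by
  rw [tsum_pos_iff_exists_pos_of_finite_support (fun _ => origamiB_nonneg h0 h1 _)]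
  · simp only [origamiB_pos_iff h0 h1, origamiYZ]
  · refine ((origamiS n).image Prod.fst).finite_toSet.subset fun x hx => ?_
    have hmem := (origamiB_pos_iff h0 h1 _).1 ((origamiB_nonneg h0 h1 _).lt_of_ne' hx)
    exact Finset.mem_coe.2 (Finset.mem_image_of_mem Prod.fst hmem)

theorem tsum_origamiB_snd_pos_iff (h0 : 0 < lam) (h1 : lam ≤ 1 / 2) (x z : ℕ) :
    0 < ∑' y, origamiB n lam (x, y, z) ↔ origamiXZ n x z := by
  rw [tsum_pos_iff_exists_pos_of_finite_support (fun _ => origamiB_nonneg h0 h1 _)]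
  · simp only [origamiB_pos_iff h0 h1, origamiXZ]
  · refine ((origamiS n).image fun p => p.2.1).finite_toSet.subset fun y hy => ?_
    have hmem := (origamiB_pos_iff h0 h1 _).1 ((origamiB_nonneg h0 h1 _).lt_of_ne' hy)
    exact Finset.mem_coe.2 (Finset.mem_image_of_mem (fun p => p.2.1) hmem)

theorem tsum_tsum_origamiB_fst_pos_iff (h0 : 0 < lam) (h1 : lam ≤ 1 / 2) (y : ℕ) :
    0 < ∑' z, ∑' x, origamiB n lam (x, y, z) ↔ ∃ z, origamiYZ n y z := by
  have hnn (z : ℕ) : 0 ≤ ∑' x, origamiB n lam (x, y, z) :=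
    tsum_nonneg fun _ => origamiB_nonneg h0 h1 _
  rw [tsum_pos_iff_exists_pos_of_finite_support hnn]
  · simp only [tsum_origamiB_fst_pos_iff h0 h1]
  · refine ((origamiS n).image fun p => p.2.2).finite_toSet.subset fun z hz => ?_
    obtain ⟨x, hx⟩ := (tsum_origamiB_fst_pos_iff h0 h1 y z).1 ((hnn z).lt_of_ne' hz)
    exact Finset.mem_coe.2 (Finset.mem_image_of_mem (fun p => p.2.2) hx)

theorem tsum_tsum_origamiB_snd_pos_iff (h0 : 0 < lam) (h1 : lam ≤ 1 / 2) (x : ℕ) :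
    0 < ∑' z, ∑' y, origamiB n lam (x, y, z) ↔ ∃ z, origamiXZ n x z := by
  have hnn (z : ℕ) : 0 ≤ ∑' y, origamiB n lam (x, y, z) :=
    tsum_nonneg fun _ => origamiB_nonneg h0 h1 _
  rw [tsum_pos_iff_exists_pos_of_finite_support hnn]
  · simp only [tsum_origamiB_snd_pos_iff h0 h1]
  · refine ((origamiS n).image fun p => p.2.2).finite_toSet.subset fun z hz => ?_
    obtain ⟨y, hy⟩ := (tsum_origamiB_snd_pos_iff h0 h1 x z).1 ((hnn z).lt_of_ne' hz)
    exact Finset.mem_coe.2 (Finset.mem_image_of_mem (fun p => p.2.2) hy)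

end Positivity

/-- A relation inside `[0, t) × [0, m)` whose domain contains `0` and `1` and all of whose common
functions are trivial. -/
structure HasTrivialCommon (R : ℕ → ℕ → Prop) (t m : ℕ) : Prop where
  lt : ∀ {u w}, R u w → u < t ∧ w < m
  zero : ∃ w, R 0 w
  one : ∃ w, R 1 w
  const : ∀ f g : ℕ → ℕ, (∀ u w, R u w → f u = g w) →
    ∀ {u w u' w'}, R u w → R u' w' → f u = f u'

/-- A relation inside `[0, 2t) × [0, 2m)` whose domain contains `0`, `1`, `t` and `t + 1` and whose
maximal common function is the pair of indicators of `t ≤ u` and `m ≤ w`. -/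
structure HasBinaryCommon (R : ℕ → ℕ → Prop) (t m : ℕ) : Prop where
  lt : ∀ {u w}, R u w → u < 2 * t ∧ w < 2 * m
  le_iff : ∀ {u w}, R u w → (t ≤ u ↔ m ≤ w)
  zero : ∃ w, R 0 w
  one : ∃ w, R 1 w
  left : ∃ w, R t w
  left_succ : ∃ w, R (t + 1) w
  const : ∀ f g : ℕ → ℕ, (∀ u w, R u w → f u = g w) →
    ∀ {u w u' w'}, R u w → R u' w' → (t ≤ u ↔ t ≤ u') → f u = f u'

theorem origamiSig_even {t k : ℕ} (hk : k % 2 = 0) : origamiSig t k = k := by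
  simp [origamiSig, hk]

theorem origamiSig_one {t : ℕ} (ht : 1 < t) : origamiSig t 1 = t + 1 := by
  have h : 1 % (2 * t) = 1 := Nat.mod_eq_of_lt (by lia)
  simp [origamiSig, h, ht, add_comm]

theorem origamiSig_lt {t k : ℕ} (hk : k < 2 * t) : origamiSig t k < 2 * t := by
  unfold origamiSig
  rw [Nat.mod_eq_of_lt hk]
  split_ifs <;> lia

theorem HasTrivialCommon.union_shift {R : ℕ → ℕ → Prop} {t m : ℕ} (h : HasTrivialCommon R t m)
    {R' : ℕ → ℕ → Prop}
    (hR' : ∀ u w, R' u w ↔ R u w ∨ ∃ u₀ w₀, R u₀ w₀ ∧ u₀ + t = u ∧ w₀ + m = w) :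
    HasBinaryCommon R' t m := by
  have hinl {u w : ℕ} (H : R u w) : R' u w := (hR' _ _).2 (.inl H)
  have hinr {u w : ℕ} (H : R u w) : R' (u + t) (w + m) := (hR' _ _).2 (.inr ⟨u, w, H, rfl, rfl⟩)
  refine ⟨?_, ?_, ?_, ?_, ?_, ?_, ?_⟩
  · intro u w H
    obtain K | ⟨u, w, K, rfl, rfl⟩ := (hR' _ _).1 H <;> have := h.lt K <;> lia
  · intro u w H
    obtain K | ⟨u, w, K, rfl, rfl⟩ := (hR' _ _).1 H <;> have := h.lt K <;> lia
  · exact h.zero.imp fun _ => hinl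
  · exact h.one.imp fun _ => hinl
  · obtain ⟨w, H⟩ := h.zero
    exact ⟨w + m, by simpa using hinr H⟩
  · obtain ⟨w, H⟩ := h.one
    exact ⟨w + m, by simpa [add_comm] using hinr H⟩
  · intro f g hfg u w u' w' H H' hiff
    obtain K | ⟨u, w, K, rfl, rfl⟩ := (hR' _ _).1 H <;>
      obtain K' | ⟨u', w', K', rfl, rfl⟩ := (hR' _ _).1 H' <;>
      have hu := h.lt K <;> have hu' := h.lt K'
    · exact h.const f g (fun _ _ L => hfg _ _ (hinl L)) K K'
    · lia
    · lia
    · exact h.const (fun u => f (u + t)) (fun w => g (w + m)) (fun _ _ L => hfg _ _ (hinr L)) K K'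

theorem HasBinaryCommon.union_fold {R : ℕ → ℕ → Prop} {t m : ℕ} (h : HasBinaryCommon R t m)
    (ht : 1 < t) (hte : t % 2 = 0) {R' : ℕ → ℕ → Prop}
    (hR' : ∀ u w, R' u w ↔
      R u w ∨ ∃ u₀ w₀, R u₀ w₀ ∧ origamiSig t u₀ = u ∧ w₀ + 2 * m = w) :
    HasTrivialCommon R' (2 * t) (2 * (2 * m)) := by
  have hinl {u w : ℕ} (H : R u w) : R' u w := (hR' _ _).2 (.inl H)
  have hinr {u w : ℕ} (H : R u w) : R' (origamiSig t u) (w + 2 * m) :=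
    (hR' _ _).2 (.inr ⟨u, w, H, rfl, rfl⟩)
  refine ⟨?_, h.zero.imp fun _ => hinl, h.one.imp fun _ => hinl, ?_⟩
  · intro u w H
    obtain K | ⟨u, w, K, rfl, rfl⟩ := (hR' _ _).1 H <;> have := h.lt K
    · lia
    · exact ⟨origamiSig_lt this.1, by lia⟩
  · intro f g hfg
    have hc {u w u' w' : ℕ} : R u w → R u' w' → (t ≤ u ↔ t ≤ u') → f u = f u' :=
      h.const f g fun _ _ K => hfg _ _ (hinl K)
    have hs {u w u' w' : ℕ} : R u w → R u' w' → (t ≤ u ↔ t ≤ u') →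
        f (origamiSig t u) = f (origamiSig t u') :=
      h.const (fun u => f (origamiSig t u)) (fun w => g (w + 2 * m))
        fun _ _ K => hfg _ _ (hinr K)
    obtain ⟨w₀, H₀⟩ := h.zero
    obtain ⟨w₁, H₁⟩ := h.one
    obtain ⟨w₂, H₂⟩ := h.left
    obtain ⟨w₃, H₃⟩ := h.left_succ
    have key₀ : f 0 = f (t + 1) := by
      have := hs H₀ H₁ (by lia)
      rwa [origamiSig_even rfl, origamiSig_one ht] at this
    have key₁ : f t = f 0 := (hc H₂ H₃ (by lia)).trans key₀.symm
    have hzero {u w : ℕ} (H : R' u w) : f u = f 0 := by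
      obtain K | ⟨u, w, K, rfl, rfl⟩ := (hR' _ _).1 H <;> by_cases hu : t ≤ u
      · exact (hc K H₂ (by lia)).trans key₁
      · exact hc K H₀ (by lia)
      · have := hs K H₂ (by lia)
        rwa [origamiSig_even hte, key₁] at this
      · have := hs K H₀ (by lia)
        rwa [origamiSig_even (k := 0) rfl] at this
    exact fun {_ _ _ _} H H' => (hzero H).trans (hzero H').symm

theorem mem_origamiS_even (k x y z : ℕ) :
    (x, y, z) ∈ origamiS (2 * k + 2) ↔ (x, y, z) ∈ origamiS (2 * k + 1) ∨
      ∃ x₀ y₀ z₀, (x₀, y₀, z₀) ∈ origamiS (2 * k + 1) ∧ x₀ + 2 ^ (k + 2) = x ∧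
        origamiSig (2 ^ (k + 1)) y₀ = y ∧ z₀ + 2 ^ (2 * k + 2) = z := by
  have h1 : (2 * k + 1) % 2 = 1 := by lia
  have h2 : (2 * k + 1 + 3) / 2 = k + 2 := by lia
  have h3 : (2 * k + 1 + 1) / 2 = k + 1 := by lia
  rw [origamiS, origamiFold, if_pos h1, h2, h3]
  simp [Prod.ext_iff]

theorem mem_origamiS_odd (k x y z : ℕ) :
    (x, y, z) ∈ origamiS (2 * (k + 1) + 1) ↔ (x, y, z) ∈ origamiS (2 * k + 2) ∨
      ∃ x₀ y₀ z₀, (x₀, y₀, z₀) ∈ origamiS (2 * k + 2) ∧ origamiSig (2 ^ (k + 2)) x₀ = x ∧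
        y₀ + 2 ^ (k + 2) = y ∧ z₀ + 2 ^ (2 * k + 3) = z := by
  have h1 : ¬ (2 * k + 1 + 1) % 2 = 1 := by lia
  have h2 : (2 * k + 1 + 1) / 2 + 1 = k + 2 := by lia
  rw [show 2 * (k + 1) + 1 = 2 * k + 1 + 2 by ring, origamiS, origamiFold, if_neg h1, h2]
  simp [Prod.ext_iff]

theorem origamiXZ_even (k x z : ℕ) :
    origamiXZ (2 * k + 2) x z ↔ origamiXZ (2 * k + 1) x z ∨
      ∃ x₀ z₀, origamiXZ (2 * k + 1) x₀ z₀ ∧ x₀ + 2 ^ (k + 2) = x ∧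
        z₀ + 2 ^ (2 * k + 2) = z := by
  simp only [origamiXZ, mem_origamiS_even]
  grind

theorem origamiYZ_even (k y z : ℕ) :
    origamiYZ (2 * k + 2) y z ↔ origamiYZ (2 * k + 1) y z ∨
      ∃ y₀ z₀, origamiYZ (2 * k + 1) y₀ z₀ ∧ origamiSig (2 ^ (k + 1)) y₀ = y ∧
        z₀ + 2 * 2 ^ (2 * k + 1) = z := by
  simp only [origamiYZ, mem_origamiS_even, ← pow_succ']
  grind

theorem origamiXZ_odd (k x z : ℕ) :
    origamiXZ (2 * (k + 1) + 1) x z ↔ origamiXZ (2 * k + 2) x z ∨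
      ∃ x₀ z₀, origamiXZ (2 * k + 2) x₀ z₀ ∧ origamiSig (2 ^ (k + 2)) x₀ = x ∧
        z₀ + 2 * 2 ^ (2 * k + 2) = z := by
  simp only [origamiXZ, mem_origamiS_odd, ← pow_succ']
  grind

theorem origamiYZ_odd (k y z : ℕ) :
    origamiYZ (2 * (k + 1) + 1) y z ↔ origamiYZ (2 * k + 2) y z ∨
      ∃ y₀ z₀, origamiYZ (2 * k + 2) y₀ z₀ ∧ y₀ + 2 ^ (k + 2) = y ∧
        z₀ + 2 ^ (2 * k + 3) = z := by
  simp only [origamiYZ, mem_origamiS_odd]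
  grind

theorem hasTrivialCommon_origamiXZ_one : HasTrivialCommon (origamiXZ 1) (2 ^ 2) (2 ^ 2) := by
  have mem (x z : ℕ) : origamiXZ 1 x z ↔ (x, z) ∈ ({(0, 0), (1, 0), (3, 1), (2, 1), (0, 2), (3, 2),
      (2, 3), (1, 3)} : Finset (ℕ × ℕ)) := by
    simp [origamiXZ, origamiS, Prod.ext_iff]
    grind
  refine ⟨?_, ⟨0, ?_⟩, ⟨0, ?_⟩, ?_⟩
  · intro u w H
    simp [mem] at H
    lia
  · simp [mem]
  · simp [mem]
  · intro f g hfg u w u' w' H H'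
    simp [mem, or_imp, forall_and] at hfg H H'
    clear mem
    grind (splits := 30)

theorem hasBinaryCommon_origamiYZ_one : HasBinaryCommon (origamiYZ 1) (2 ^ 1) (2 ^ 1) := by
  have mem (y z : ℕ) : origamiYZ 1 y z ↔ (y, z) ∈ ({(0, 0), (1, 0), (0, 1), (1, 1), (2, 2), (3, 2),
      (3, 3), (2, 3)} : Finset (ℕ × ℕ)) := by
    simp [origamiYZ, origamiS, Prod.ext_iff]
    grind
  refine ⟨?_, ?_, ⟨0, ?_⟩, ⟨0, ?_⟩, ⟨2, ?_⟩, ⟨2, ?_⟩, ?_⟩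
  · intro u w H
    simp [mem] at H
    lia
  · intro u w H
    simp [mem] at H
    lia
  · simp [mem]
  · simp [mem]
  · simp [mem]
  · simp [mem]
  · intro f g hfg u w u' w' H H'
    simp [mem, or_imp, forall_and] at hfg H H'
    clear mem
    grind (splits := 30)

theorem HasTrivialCommon.origamiXZ_even {k : ℕ}
    (h : HasTrivialCommon (origamiXZ (2 * k + 1)) (2 ^ (k + 2)) (2 ^ (2 * k + 2))) :
    HasBinaryCommon (origamiXZ (2 * k + 2)) (2 ^ (k + 2)) (2 ^ (2 * k + 2)) :=
  h.union_shift (_root_.origamiXZ_even k)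

theorem HasBinaryCommon.origamiYZ_even {k : ℕ}
    (h : HasBinaryCommon (origamiYZ (2 * k + 1)) (2 ^ (k + 1)) (2 ^ (2 * k + 1))) :
    HasTrivialCommon (origamiYZ (2 * k + 2)) (2 ^ (k + 2)) (2 ^ (2 * k + 3)) := by
  have := h.union_fold (Nat.one_lt_two_pow (by lia)) (by simp [pow_succ])
    (_root_.origamiYZ_even k)
  simpa only [← pow_succ'] using this

theorem hasCommon_origami_odd (k : ℕ) :
    HasTrivialCommon (origamiXZ (2 * k + 1)) (2 ^ (k + 2)) (2 ^ (2 * k + 2)) ∧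
      HasBinaryCommon (origamiYZ (2 * k + 1)) (2 ^ (k + 1)) (2 ^ (2 * k + 1)) := by
  induction k with
  | zero => exact ⟨hasTrivialCommon_origamiXZ_one, hasBinaryCommon_origamiYZ_one⟩
  | succ k ih =>
    refine ⟨?_, ih.2.origamiYZ_even.union_shift (origamiYZ_odd k)⟩
    have := ih.1.origamiXZ_even.union_fold (Nat.one_lt_two_pow (by lia)) (by simp [pow_succ])
      (origamiXZ_odd k)
    simp only [← pow_succ'] at this
    exact this

theorem HasBinaryCommon.isMaximalCommon {R : ℕ → ℕ → Prop} {t m : ℕ}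
    (h : HasBinaryCommon R t m) (ht : 0 < t) :
    (∀ u w, R u w → (if t ≤ u then 1 else 0) = if m ≤ w then 1 else 0) ∧
    (∃ u, (∃ w, R u w) ∧ (if t ≤ u then 1 else 0) = 0) ∧
    (∃ u, (∃ w, R u w) ∧ (if t ≤ u then 1 else 0) = 1) ∧
    (∀ f g : ℕ → ℕ, (∀ u w, R u w → f u = g w) → ∀ u u', (∃ w, R u w) → (∃ w, R u' w) →
      ((if t ≤ u then 1 else 0) = if t ≤ u' then 1 else 0) → f u = f u') := by
  refine ⟨fun u w H => by simp only [h.le_iff H], ⟨0, h.zero, by simp [ht.ne']⟩,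
    ⟨t, h.left, by simp⟩, ?_⟩
  rintro f g hfg u u' ⟨w, H⟩ ⟨w', H'⟩ hu
  exact h.const f g hfg H H' (by split_ifs at hu <;> lia)

/-- **Proposition 1, part 2 (binary half).** For odd `n` the pair
`(origamiFOddY n, origamiGZ n)` is a common function of `Y` and `Z` for `b^{(n,λ)}` taking
both values `0` and `1` on the support, and every common function of `Y` and `Z` factors
through it (it is constant on each level set of `origamiFOddY n` within the support).
For even `n` the same holds for `X` and `Z` with `origamiFEvenX n`. -/
theorem origami_JYZ_JXZ_binary
    (n : ℕ) (hn : 1 ≤ n) (lam : ℝ) (hlam0 : 0 < lam) (hlam1 : lam ≤ 1 / 2) :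
    (Odd n →
      (∀ y z : ℕ, (0 < ∑' x : ℕ, origamiB n lam (x, y, z)) →
        origamiFOddY n y = origamiGZ n z) ∧
      (∃ y : ℕ, (0 < ∑' z : ℕ, ∑' x : ℕ, origamiB n lam (x, y, z)) ∧
        origamiFOddY n y = 0) ∧
      (∃ y : ℕ, (0 < ∑' z : ℕ, ∑' x : ℕ, origamiB n lam (x, y, z)) ∧
        origamiFOddY n y = 1) ∧
      (∀ f' g' : ℕ → ℕ,
        (∀ y z : ℕ, (0 < ∑' x : ℕ, origamiB n lam (x, y, z)) → f' y = g' z) →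
        ∀ y y' : ℕ,
          (0 < ∑' z : ℕ, ∑' x : ℕ, origamiB n lam (x, y, z)) →
          (0 < ∑' z : ℕ, ∑' x : ℕ, origamiB n lam (x, y', z)) →
          origamiFOddY n y = origamiFOddY n y' → f' y = f' y')) ∧
    (Even n →
      (∀ x z : ℕ, (0 < ∑' y : ℕ, origamiB n lam (x, y, z)) →
        origamiFEvenX n x = origamiGZ n z) ∧
      (∃ x : ℕ, (0 < ∑' z : ℕ, ∑' y : ℕ, origamiB n lam (x, y, z)) ∧
        origamiFEvenX n x = 0) ∧
      (∃ x : ℕ, (0 < ∑' z : ℕ, ∑' y : ℕ, origamiB n lam (x, y, z)) ∧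
        origamiFEvenX n x = 1) ∧
      (∀ f' g' : ℕ → ℕ,
        (∀ x z : ℕ, (0 < ∑' y : ℕ, origamiB n lam (x, y, z)) → f' x = g' z) →
        ∀ x x' : ℕ,
          (0 < ∑' z : ℕ, ∑' y : ℕ, origamiB n lam (x, y, z)) →
          (0 < ∑' z : ℕ, ∑' y : ℕ, origamiB n lam (x', y, z)) →
          origamiFEvenX n x = origamiFEvenX n x' → f' x = f' x')) := by
  simp only [tsum_tsum_origamiB_fst_pos_iff hlam0 hlam1, tsum_tsum_origamiB_snd_pos_iff hlam0 hlam1,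
    tsum_origamiB_fst_pos_iff hlam0 hlam1, tsum_origamiB_snd_pos_iff hlam0 hlam1,
    origamiFOddY, origamiFEvenX, origamiGZ]
  constructor
  · rintro ⟨k, rfl⟩
    rw [show (2 * k + 1 + 1) / 2 = k + 1 by lia]
    exact (hasCommon_origami_odd k).2.isMaximalCommon (by positivity)
  · rintro ⟨j, rfl⟩
    obtain ⟨k, rfl⟩ : ∃ k, j = k + 1 := ⟨j - 1, by lia⟩
    rw [show k + 1 + (k + 1) = 2 * k + 2 by ring, show (2 * k + 2) / 2 + 1 = k + 2 by lia]
    exact (hasCommon_origami_odd k).1.origamiXZ_even.isMaximalCommon (by positivity)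
end

section
/- For every integer n ≥ 1: the support set S_n of the origami distribution satisfies S_n ⊆ {0,…,2^{⌊n/2⌋+2}−1} × {0,…,2^{⌈n/2⌉+1}−1} × {0,…,2^{n+1}−1}; for every z ∈ {0,…,2^{n+1}−1} there are exactly two pairs (x,y) with (x,y,z) ∈ S_n, and these two pairs have x-coordinates of opposite parity (one even, one odd) and distinct y-coordinates. Consequently, for every 0 < λ ≤ 1/2, b^{(n,λ)} is a probability distribution (its values sum to 1) and its Z-marginal is uniform: Σ_{x,y} b^{(n,λ)}(x,y,z) = 2^{−(n+1)} for every z ∈ {0,…,2^{n+1}−1}. -/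
/-- `s` lies in the box `[0,X) × [0,Y) × [0,Z)`, and its fiber over each `z < Z` consists of two
points whose `x`-coordinates have opposite parity and whose `y`-coordinates differ. -/
def IsTwoPerFiber (s : Finset (ℕ × ℕ × ℕ)) (X Y Z : ℕ) : Prop :=
  (∀ p ∈ s, p.1 < X ∧ p.2.1 < Y ∧ p.2.2 < Z) ∧
  ∀ z < Z, ∃ x₀ y₀ x₁ y₁ : ℕ, x₀ % 2 = 0 ∧ x₁ % 2 = 1 ∧ y₀ ≠ y₁ ∧
    s.filter (fun p => p.2.2 = z) = {(x₀, y₀, z), (x₁, y₁, z)}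

theorem IsTwoPerFiber.union_image {s : Finset (ℕ × ℕ × ℕ)} {X Y Z X' Y' : ℕ}
    (h : IsTwoPerFiber s X Y Z) (hX : X ≤ X') (hY : Y ≤ Y') {f g : ℕ → ℕ}
    (hf : ∀ x < X, f x < X') (hg : ∀ y < Y, g y < Y') (hpar : ∀ x < X, f x % 2 = x % 2)
    (hinj : ∀ y < Y, ∀ y' < Y, g y = g y' → y = y') :
    IsTwoPerFiber (s ∪ s.image fun p => (f p.1, g p.2.1, p.2.2 + Z)) X' Y' (2 * Z) := by
  obtain ⟨hb, hs⟩ := h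
  refine ⟨fun p hp => ?_, fun z hz => ?_⟩
  · rcases Finset.mem_union.1 hp with hp | hp
    · obtain ⟨h1, h2, h3⟩ := hb p hp
      omega
    · obtain ⟨q, hq, rfl⟩ := Finset.mem_image.1 hp
      obtain ⟨h1, h2, h3⟩ := hb q hq
      exact ⟨hf _ h1, hg _ h2, by dsimp only; omega⟩
  · rcases lt_or_ge z Z with hzZ | hzZ
    · obtain ⟨x₀, y₀, x₁, y₁, h0, h1, hne, heq⟩ := hs z hzZ
      refine ⟨x₀, y₀, x₁, y₁, h0, h1, hne, ?_⟩
      have hempty : (s.image fun p => (f p.1, g p.2.1, p.2.2 + Z)).filter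
          (fun p => p.2.2 = z) = ∅ := by
        refine Finset.filter_eq_empty_iff.2 fun p hp => ?_
        obtain ⟨q, -, rfl⟩ := Finset.mem_image.1 hp
        dsimp only
        omega
      rw [Finset.filter_union, heq, hempty, Finset.union_empty]
    · obtain ⟨w, rfl⟩ := Nat.exists_eq_add_of_le' hzZ
      obtain ⟨x₀, y₀, x₁, y₁, h0, h1, hne, heq⟩ := hs w (by omega)
      have m0 : (x₀, y₀, w) ∈ s :=
        Finset.filter_subset (fun p => p.2.2 = w) s (by rw [heq]; simp)
      have m1 : (x₁, y₁, w) ∈ s :=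
        Finset.filter_subset (fun p => p.2.2 = w) s (by rw [heq]; simp)
      obtain ⟨bx0, by0, -⟩ := hb _ m0
      obtain ⟨bx1, by1, -⟩ := hb _ m1
      refine ⟨f x₀, g y₀, f x₁, g y₁, by rw [hpar _ bx0, h0], by rw [hpar _ bx1, h1],
        fun e => hne (hinj _ by0 _ by1 e), ?_⟩
      have hempty : s.filter (fun p => p.2.2 = w + Z) = ∅ := by
        refine Finset.filter_eq_empty_iff.2 fun p hp => ?_
        have := (hb p hp).2.2
        omega
      rw [Finset.filter_union, hempty, Finset.empty_union, Finset.filter_image]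
      simp only [Nat.add_right_cancel_iff]
      rw [heq, Finset.image_insert, Finset.image_singleton]

theorem origamiSig_mod_two {t k : ℕ} (ht : 2 ∣ t) (hk : k < 2 * t) :
    origamiSig t k % 2 = k % 2 := by
  unfold origamiSig
  rw [Nat.mod_eq_of_lt hk]
  split_ifs <;> omega

theorem origamiSig_injOn {t : ℕ} (ht : 2 ∣ t) :
    ∀ y < 2 * t, ∀ y' < 2 * t, origamiSig t y = origamiSig t y' → y = y' := by
  intro y hy y' hy' h
  unfold origamiSig at h
  rw [Nat.mod_eq_of_lt hy, Nat.mod_eq_of_lt hy'] at h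
  split_ifs at h <;> omega

theorem isTwoPerFiber_origamiS_one : IsTwoPerFiber (origamiS 1) 4 4 4 := by
  refine ⟨by decide, fun z hz => ?_⟩
  interval_cases z
  · exact ⟨0, 0, 1, 1, by decide⟩
  · exact ⟨2, 1, 3, 0, by decide⟩
  · exact ⟨0, 2, 3, 3, by decide⟩
  · exact ⟨2, 3, 1, 2, by decide⟩

theorem isTwoPerFiber_origamiS (n : ℕ) (hn : 1 ≤ n) :
    IsTwoPerFiber (origamiS n) (2 ^ (n / 2 + 2)) (2 ^ ((n + 1) / 2 + 1)) (2 ^ (n + 1)) := by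
  induction n, hn using Nat.le_induction with
  | base => exact isTwoPerFiber_origamiS_one
  | succ n hn ih =>
    have hS : origamiS (n + 1) = origamiS n ∪ origamiFold n (origamiS n) := by
      obtain ⟨m, rfl⟩ := Nat.exists_eq_add_of_le' hn
      rfl
    rw [hS, pow_succ' 2 (n + 1), origamiFold]
    split_ifs with hodd
    · rw [show n / 2 + 2 = (n + 3) / 2 by omega, pow_succ' 2 ((n + 1) / 2)] at ih
      rw [show (n + 1) / 2 + 2 = (n + 3) / 2 + 1 by omega,
        show (n + 1 + 1) / 2 + 1 = (n + 1) / 2 + 1 by omega,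
        pow_succ' 2 ((n + 3) / 2), pow_succ' 2 ((n + 1) / 2)]
      have ht : 2 ∣ 2 ^ ((n + 1) / 2) := dvd_pow_self 2 (by omega)
      have hX : 2 ∣ 2 ^ ((n + 3) / 2) := dvd_pow_self 2 (by omega)
      exact ih.union_image (f := fun x => x + 2 ^ ((n + 3) / 2)) (by omega) le_rfl
        (fun x hx => by omega) (fun y => origamiSig_lt)
        (fun x _ => by omega) (origamiSig_injOn ht)
    · rw [show n / 2 + 2 = n / 2 + 1 + 1 by omega, show (n + 1) / 2 + 1 = n / 2 + 1 by omega,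
        pow_succ' 2 (n / 2 + 1)] at ih
      rw [show (n + 1) / 2 + 2 = n / 2 + 1 + 1 by omega,
        show (n + 1 + 1) / 2 + 1 = n / 2 + 1 + 1 by omega, pow_succ' 2 (n / 2 + 1)]
      have ht : 2 ∣ 2 ^ (n / 2 + 1) := dvd_pow_self 2 (by omega)
      exact ih.union_image (g := fun y => y + 2 ^ (n / 2 + 1)) le_rfl (by omega)
        (fun x => origamiSig_lt) (fun y hy => by omega)
        (fun x => origamiSig_mod_two ht) (fun y _ y' _ h => by omega)

theorem origamiB_add_origamiB {n z x₀ y₀ x₁ y₁ : ℕ} (h0 : x₀ % 2 = 0) (h1 : x₁ % 2 = 1)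
    (heq : (origamiS n).filter (fun p => p.2.2 = z) = {(x₀, y₀, z), (x₁, y₁, z)}) (lam : ℝ) :
    origamiB n lam (x₀, y₀, z) + origamiB n lam (x₁, y₁, z) = 1 / 2 ^ (n + 1) := by
  have m0 : (x₀, y₀, z) ∈ origamiS n :=
    Finset.filter_subset (fun p => p.2.2 = z) _ (by rw [heq]; simp)
  have m1 : (x₁, y₁, z) ∈ origamiS n :=
    Finset.filter_subset (fun p => p.2.2 = z) _ (by rw [heq]; simp)
  rw [origamiB, origamiB, if_pos m0, if_pos m1, if_pos h0, if_neg (by dsimp only; omega)]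
  ring

/-- Support bounds, two-events-per-`z` structure, normalization, and uniform Eve marginal
of the origami distributions. -/
theorem origami_support_structure (n : ℕ) (hn : 1 ≤ n) :
    (∀ p ∈ origamiS n,
      p.1 < 2 ^ (n / 2 + 2) ∧ p.2.1 < 2 ^ ((n + 1) / 2 + 1) ∧ p.2.2 < 2 ^ (n + 1)) ∧
    (∀ z : ℕ, z < 2 ^ (n + 1) →
      ∃ x₀ y₀ x₁ y₁ : ℕ, x₀ % 2 = 0 ∧ x₁ % 2 = 1 ∧ y₀ ≠ y₁ ∧
        (origamiS n).filter (fun p => p.2.2 = z) = {(x₀, y₀, z), (x₁, y₁, z)}) ∧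
    (∀ lam : ℝ, 0 < lam → lam ≤ 1 / 2 →
      (∑' p : ℕ × ℕ × ℕ, origamiB n lam p) = 1 ∧
      ∀ z : ℕ, z < 2 ^ (n + 1) →
        (∑' x : ℕ, ∑' y : ℕ, origamiB n lam (x, y, z)) = 1 / 2 ^ (n + 1)) := by
  have key := isTwoPerFiber_origamiS n hn
  refine ⟨key.1, key.2, fun lam _ _ => ⟨?_, fun z hz => ?_⟩⟩
  · rw [tsum_eq_sum (s := origamiS n) fun p hp => by rw [origamiB, if_neg hp],
      ← Finset.sum_fiberwise_of_maps_to (t := Finset.range (2 ^ (n + 1))) (g := fun p => p.2.2)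
        fun p hp => Finset.mem_range.2 (key.1 p hp).2.2]
    have hfib : ∀ z ∈ Finset.range (2 ^ (n + 1)),
        ∑ p ∈ origamiS n with p.2.2 = z, origamiB n lam p = 1 / 2 ^ (n + 1) := by
      intro z hz
      obtain ⟨x₀, y₀, x₁, y₁, h0, h1, -, heq⟩ := key.2 z (Finset.mem_range.1 hz)
      rw [heq, Finset.sum_pair (by rintro ⟨⟩; omega)]
      exact origamiB_add_origamiB h0 h1 heq lam
    rw [Finset.sum_congr rfl hfib, Finset.sum_const, Finset.card_range, nsmul_eq_mul]
    push_cast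
    field_simp
  · obtain ⟨x₀, y₀, x₁, y₁, h0, h1, -, heq⟩ := key.2 z hz
    have hne : x₀ ≠ x₁ := by omega
    have hzero : ∀ x y, ¬(x = x₀ ∧ y = y₀) → ¬(x = x₁ ∧ y = y₁) →
        origamiB n lam (x, y, z) = 0 := by
      intro x y hxy hxy'
      refine if_neg fun hmem => ?_
      have : (x, y, z) ∈ ({(x₀, y₀, z), (x₁, y₁, z)} : Finset (ℕ × ℕ × ℕ)) :=
        heq ▸ Finset.mem_filter.2 ⟨hmem, rfl⟩
      simp only [Finset.mem_insert, Finset.mem_singleton, Prod.mk.injEq, and_true] at this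
      exact this.elim hxy hxy'
    rw [tsum_eq_sum (s := {x₀, x₁}), Finset.sum_pair hne, tsum_eq_single y₀, tsum_eq_single y₁]
    · exact origamiB_add_origamiB h0 h1 heq lam
    · exact fun y hy => hzero _ _ (fun h => hne h.1.symm) fun h => hy h.2
    · exact fun y hy => hzero _ _ (fun h => hy h.2) fun h => hne h.1
    · intro x hx
      simp only [Finset.mem_insert, Finset.mem_singleton, not_or] at hx
      simp only [hzero x _ (fun h => hx.1 h.1) (fun h => hx.2 h.1), tsum_zero]
end
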